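/- Let X be a Λ-ring over K admitting an integral model. If for some 𝔭 ∈ P_K the endomorphism ψ_𝔭 : X → X is bijective, then there exists σ ∈ Gal(K̄/K) such that s ∘ ψ_𝔭 = σ ∘ s for every K-algebra homomorphism s : X → K̄; that is, the action of ψ_𝔭 by pullback on the set of K-algebra homomorphisms X → K̄ equals the action of some element of Gal(K̄/K). -/

import Mathlib

open NumberField
set_option synthInstance.maxHeartbeats 1000000
set_option maxHeartbeats 1000000

/-- The commutative monoid of nonzero ideals of a domain (under ideal multiplication). -/
def NZI (R : Type*) [CommRing R] [IsDomain R] : Submonoid (Ideal R) where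
  carrier := {I | I ≠ ⊥}
  mul_mem' := by
    intro a b ha hb h
    rcases Ideal.mul_eq_bot.mp h with h' | h'
    · exact ha h'
    · exact hb h'
  one_mem' := by
    simpa [Ideal.one_eq_top] using (top_ne_bot : (⊤ : Ideal R) ≠ ⊥)

/-- A fixed algebraic closure of `K`. -/
abbrev Kbar (K : Type*) [Field K] := AlgebraicClosure K

variable (K : Type*) [Field K] [NumberField K]
variable (X : Type*) [CommRing X] [Algebra K X]

/-- `A` is an integral model of the `Λ`-ring `(X, ψ)` over `K`: an `O_K`-subalgebra of `X`
finitely generated as an `O_K`-module, spanning `X` over `K`, stable under the `ψ_𝔭`, and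
with `ψ_𝔭(a) - a^{N𝔭} ∈ 𝔭A` for all `a ∈ A` and all nonzero primes `𝔭`. -/
def IsIntegralModel (ψ : NZI (𝓞 K) →* (X →ₐ[K] X)) (A : Subalgebra (𝓞 K) X) : Prop :=
  (Subalgebra.toSubmodule A).FG ∧
  Submodule.span K (A : Set X) = ⊤ ∧
  (∀ (p : Ideal (𝓞 K)) (_ : p.IsPrime) (hp : p ≠ ⊥), ∀ a ∈ A, ψ ⟨p, hp⟩ a ∈ A) ∧
  (∀ (p : Ideal (𝓞 K)) (_ : p.IsPrime) (hp : p ≠ ⊥), ∀ a ∈ A,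
    ψ ⟨p, hp⟩ a - a ^ Ideal.absNorm p ∈
      Submodule.span (𝓞 K) {y | ∃ r ∈ p, ∃ b ∈ A, y = r • b})

theorem uniq_lift {O A R : Type*} [CommRing O] [CommRing A] [CommRing R] [IsDomain R]
    [Algebra O A] [Algebra O R] [Module.Finite O A] (p : Ideal O) (P : Ideal R) (hP : P ≠ ⊤)
    (hpP : ∀ r ∈ p, algebraMap O R r ∈ P) (Q : ℕ) (hQ : (Q : R) ∈ P)
    (t₁ t₂ : A →ₐ[O] R)
    (h : ∀ a, ∃ c ∈ p.map (algebraMap O A), t₁ a = t₁ (a ^ Q + c) ∧ t₂ a = t₂ (a ^ Q + c))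
    (hc : ∀ a, t₁ a - t₂ a ∈ P) : t₁ = t₂ := by
  set I : Ideal R := Ideal.span (Set.range fun a => t₁ a - t₂ a) with hI
  have hmem : ∀ a, t₁ a - t₂ a ∈ I := fun a => Ideal.subset_span ⟨a, rfl⟩
  have hfg : I.FG := by
    obtain ⟨S, hS⟩ := Module.Finite.fg_top (R := O) (M := A)
    classical
    refine ⟨S.image (fun a => t₁ a - t₂ a), le_antisymm (Ideal.span_mono ?_) (Ideal.span_le.2 ?_)⟩
    · intro x hx
      simp only [Finset.coe_image] at hx
      obtain ⟨a, _, rfl⟩ := hx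
      exact ⟨a, rfl⟩
    · rintro _ ⟨a, rfl⟩
      have ha : a ∈ Submodule.span O (S : Set A) := hS ▸ Submodule.mem_top
      simp only [SetLike.mem_coe]
      induction ha using Submodule.span_induction with
      | mem x hx => exact Ideal.subset_span (by simpa using ⟨x, hx, rfl⟩)
      | zero => simp
      | add x y _ _ hx hy =>
        rw [map_add, map_add, add_sub_add_comm]; exact add_mem hx hy
      | smul r x _ hx =>
        rw [map_smul, map_smul, ← smul_sub, Algebra.smul_def]; exact Ideal.mul_mem_left _ _ hx
  have hcI : ∀ c ∈ p.map (algebraMap O A), t₁ c - t₂ c ∈ P * I := by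
    intro c hc'
    have : c ∈ (p • ⊤ : Submodule O A) := by rw [Ideal.smul_top_eq_map]; exact hc'
    induction this using Submodule.smul_induction_on' with
    | smul r hr x _ =>
      rw [map_smul, map_smul, ← smul_sub, Algebra.smul_def]
      exact Ideal.mul_mem_mul (hpP r hr) (hmem x)
    | add x hx y hy h1 h2 =>
      rw [map_add, map_add, add_sub_add_comm]
      refine add_mem (h1 ?_) (h2 ?_)
      · rw [Ideal.smul_top_eq_map] at hx; exact hx
      · rw [Ideal.smul_top_eq_map] at hy; exact hy
  have hle : I ≤ P • I := by
    refine Ideal.span_le.2 ?_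
    rintro _ ⟨a, rfl⟩
    obtain ⟨c, hcJ, e1, e2⟩ := h a
    simp only [SetLike.mem_coe, smul_eq_mul]
    rw [e1, e2, map_add, map_add, add_sub_add_comm, map_pow, map_pow]
    refine add_mem ?_ (hcI c hcJ)
    rw [← (Commute.all (t₁ a) (t₂ a)).geom_sum₂_mul Q]
    refine Ideal.mul_mem_mul ?_ (hmem a)
    have := Ideal.Quotient.eq.2 (hc a)
    rw [← Ideal.Quotient.eq_zero_iff_mem] at hQ ⊢
    simp only [map_sum, map_mul, map_pow, this]
    rw [geom_sum₂_self, ← map_natCast (Ideal.Quotient.mk P), hQ, zero_mul]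
  obtain ⟨r, hr1, hr2⟩ := Submodule.exists_sub_one_mem_and_smul_eq_zero_of_fg_of_le_smul P I hfg hle
  have hr : r ≠ 0 := by
    rintro rfl
    apply hP; rw [Ideal.eq_top_iff_one]; simpa using hr1
  ext a
  have := hr2 _ (hmem a)
  simpa [hr, sub_eq_zero] using this

theorem exists_frob (K L : Type*) [Field K] [NumberField K] [Field L] [NumberField L] [Algebra K L]
    [IsGalois K L] (p : Ideal (𝓞 K)) (hp : p.IsPrime) (hp0 : p ≠ ⊥) :
    ∃ (τ : 𝓞 L ≃ₐ[𝓞 K] 𝓞 L) (Q : Ideal (𝓞 L)), Q ≠ ⊤ ∧ (∀ r ∈ p, algebraMap _ (𝓞 L) r ∈ Q) ∧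
      ((Ideal.absNorm p : ℕ) : 𝓞 L) ∈ Q ∧ ∀ x, τ x - x ^ Ideal.absNorm p ∈ Q := by
  have : p.IsMaximal := hp.isMaximal hp0
  obtain ⟨Q, hQ, hQp⟩ := Ideal.exists_maximal_ideal_liesOver_of_isIntegral p (S := 𝓞 L)
  have hQ0 : Q ≠ ⊥ := Ideal.ne_bot_of_liesOver_of_ne_bot hp0 Q
  have : Finite (𝓞 L ⧸ Q) := Ideal.finiteQuotientOfFreeOfNeBot Q hQ0
  have := Algebra.isInvariant_of_isGalois' (𝓞 K) K L (𝓞 L)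
  have : Finite (𝓞 L ≃ₐ[𝓞 K] 𝓞 L) := Finite.of_equiv _ (galRestrict (𝓞 K) K L (𝓞 L)).toEquiv
  obtain ⟨τ, hτ⟩ := IsArithFrobAt.exists_of_isInvariant (𝓞 K) (𝓞 L ≃ₐ[𝓞 K] 𝓞 L) Q
  have hle : ∀ r ∈ p, algebraMap _ (𝓞 L) r ∈ Q := fun r hr => by
    rw [hQp.over] at hr; exact hr
  refine ⟨τ, Q, hQ.ne_top, hle, ?_, fun x => ?_⟩
  · have := hle _ (Ideal.absNorm_mem p)
    simpa using this
  · have := hτ x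
    rw [← hQp.over] at this
    exact this

theorem core_galois (L : Type*) [Field L] [NumberField L] [Algebra K L] [IsGalois K L]
    [Module.Finite K X]
    (ψ : NZI (𝓞 K) →* (X →ₐ[K] X)) (A : Subalgebra (𝓞 K) X)
    (hA : IsIntegralModel K X ψ A)
    (p : Ideal (𝓞 K)) (hprime : p.IsPrime) (hp : p ≠ ⊥)
    (hbij : Function.Bijective (ψ ⟨p, hp⟩)) :
    ∃ σ : L ≃ₐ[K] L, ∀ (s : X →ₐ[K] L) (x : X), s (ψ ⟨p, hp⟩ x) = σ (s x) := by
  obtain ⟨hfg, hspan, hst, hfr⟩ := hA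
  replace hst := hst p hprime hp
  replace hfr := hfr p hprime hp
  set f := ψ ⟨p, hp⟩ with hf
  set q := Ideal.absNorm p with hq
  have hfin : Module.Finite (𝓞 K) A := Module.Finite.iff_fg.2 hfg
  let g : A →ₐ[𝓞 K] A := ((f.restrictScalars (𝓞 K)).comp A.val).codRestrict A
    (fun a => hst a a.2)
  have hg : ∀ a : A, ((g a : A) : X) = f a := fun a => rfl
  have hJ : ∀ a : A, g a - a ^ q ∈ p.map (algebraMap (𝓞 K) A) := by
    intro a
    have h1 := hfr a a.2
    have h2 : Submodule.span (𝓞 K) {y | ∃ r ∈ p, ∃ b ∈ A, y = r • b} ≤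
        (((p.map (algebraMap (𝓞 K) A)).restrictScalars (𝓞 K)).map A.val.toLinearMap) := by
      rw [Submodule.span_le]
      rintro _ ⟨r, hr, b, hb, rfl⟩
      refine ⟨r • ⟨b, hb⟩, ?_, rfl⟩
      simp only [Submodule.coe_restrictScalars, SetLike.mem_coe, Algebra.smul_def]
      exact Ideal.mul_mem_right _ _ (Ideal.mem_map_of_mem _ hr)
    obtain ⟨y, hy, hy2⟩ := h2 h1
    have : y = g a - a ^ q := Subtype.ext hy2
    rw [← this]; exact hy
  have hJm : ∀ (m : ℕ) (a : A), g^[m] a - a ^ q ^ m ∈ p.map (algebraMap (𝓞 K) A) := by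
    intro m
    induction m with
    | zero => intro a; simp
    | succ m ih =>
      intro a
      have h1 := ih (g a)
      have h2 := Ideal.Quotient.eq.2 (hJ a)
      rw [← Ideal.Quotient.eq] at h1 ⊢
      rw [Function.iterate_succ_apply, h1, map_pow, h2, ← map_pow, ← pow_mul, ← pow_succ']
  -- the pullback permutation
  let F : (X →ₐ[K] L) → (X →ₐ[K] L) := fun s => s.comp f
  have hF : Function.Injective F := by
    intro s t hst
    ext x
    obtain ⟨y, rfl⟩ := hbij.2 x
    exact DFunLike.congr_fun hst y
  let E : Equiv.Perm (X →ₐ[K] L) := Equiv.ofBijective F (Finite.injective_iff_bijective.1 hF)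
  obtain ⟨m, hm, hEm⟩ := (isOfFinOrder_of_finite E).exists_pow_eq_one
  have hiter : ∀ (n : ℕ) (s : X →ₐ[K] L) (a : A), s (g^[n] a : A) = (E ^ n) s a := by
    intro n
    induction n with
    | zero => intro s a; rfl
    | succ n ih =>
      intro s a
      rw [Function.iterate_succ_apply', hg, pow_succ]
      exact ih (F s) a
  have hper : ∀ (s : X →ₐ[K] L) (a : A), s (g^[m] a : A) = s a := by
    intro s a; rw [hiter, hEm]; rfl
  have hint : ∀ (s : X →ₐ[K] L) (a : A), IsIntegral ℤ (s a) := by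
    intro s a
    have h1 : IsIntegral (𝓞 K) a := Algebra.IsIntegral.isIntegral a
    have h2 := h1.map ((s.restrictScalars (𝓞 K)).comp A.val)
    exact isIntegral_trans (R := ℤ) (A := 𝓞 K) _ h2
  let res : (X →ₐ[K] L) → (A →ₐ[𝓞 K] 𝓞 L) := fun s =>
    { toFun := fun a => ⟨s a, hint s a⟩
      map_one' := by ext; exact map_one s
      map_mul' := by intro a b; ext; exact map_mul s (a : X) (b : X)
      map_zero' := by ext; exact map_zero s
      map_add' := by intro a b; ext; exact map_add s (a : X) (b : X)
      commutes' := by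
        intro r; ext
        exact ((s.restrictScalars (𝓞 K)).comp A.val).commutes r }
  have hres : ∀ s a, ((res s a : 𝓞 L) : L) = s a := fun s a => rfl
  obtain ⟨τ, Q, hQ, hpQ, hqQ, hτ⟩ := exists_frob K L p hprime hp
  let σ := (galRestrict (𝓞 K) K L (𝓞 L)).symm τ
  have hσ : ∀ x : 𝓞 L, σ (x : L) = (τ x : 𝓞 L) := by
    intro x
    have := algebraMap_galRestrict_apply (𝓞 K) (K := K) (L := L) (B := 𝓞 L) σ x
    rw [← this]
    simp [σ]
  refine ⟨σ, fun s => ?_⟩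
  have key : res (F s) = (τ : 𝓞 L →ₐ[𝓞 K] 𝓞 L).comp (res s) := by
    have hpr : ∀ s : X →ₐ[K] L, ∀ a, res s (g^[m] a) = res s a := by
      intro s a; ext; exact hper s a
    refine uniq_lift p Q hQ hpQ (q ^ m) ?_ _ _ (fun a => ⟨g^[m] a - a ^ q ^ m, hJm m a, ?_, ?_⟩) ?_
    · push_cast
      exact Ideal.pow_mem_of_mem _ hqQ _ hm
    · rw [add_sub_cancel, hpr]
    · rw [add_sub_cancel, AlgHom.comp_apply, AlgHom.comp_apply, hpr]
    · intro a
      have h1 := hτ (res s a)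
      have h2 : res (F s) a = res s (g a) := by ext; rfl
      have h3 : res s (g a) - (res s a) ^ q ∈ Q := by
        rw [← map_pow, ← map_sub]
        have : p.map (algebraMap (𝓞 K) A) ≤ Q.comap (res s) := by
          rw [Ideal.map_le_iff_le_comap]
          intro r hr
          rw [Ideal.mem_comap, Ideal.mem_comap, AlgHom.commutes]
          exact hpQ r hr
        exact this (hJ a)
      rw [h2]
      have := sub_mem h3 h1
      rw [sub_sub_sub_cancel_right] at this
      exact this
  have hA' : ∀ a ∈ A, s (f a) = σ (s a) := by
    intro a ha
    have := congrArg (fun x : 𝓞 L => (x : L)) (DFunLike.congr_fun key ⟨a, ha⟩)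
    have h2 := hσ (res s ⟨a, ha⟩)
    exact this.trans h2.symm
  intro x
  have hx : x ∈ Submodule.span K (A : Set X) := hspan ▸ Submodule.mem_top
  induction hx using Submodule.span_induction with
  | mem x hx => exact hA' x hx
  | zero => simp
  | add x y _ _ hx hy => simp [hx, hy]
  | smul r x _ hx =>
    rw [map_smul f, map_smul s, map_smul s, hx]
    exact (map_smul σ.toLinearEquiv r (s x)).symm

/-- Let `X` be a `Λ`-ring over `K` (a finite-dimensional reduced
commutative `K`-algebra with commuting Frobenius lifts `ψ`) admitting an integral model.
If `ψ_𝔭` is bijective for some nonzero prime `𝔭`, then there is `σ ∈ Gal(K̄/K)` such that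
`s ∘ ψ_𝔭 = σ ∘ s` for every `K`-algebra homomorphism `s : X → K̄`. -/
theorem psi_bijective_comes_from_galois [Module.Finite K X] [IsReduced X]
    (ψ : NZI (𝓞 K) →* (X →ₐ[K] X)) (A : Subalgebra (𝓞 K) X)
    (hA : IsIntegralModel K X ψ A)
    (p : Ideal (𝓞 K)) (hprime : p.IsPrime) (hp : p ≠ ⊥)
    (hbij : Function.Bijective (ψ ⟨p, hp⟩)) :
    ∃ σ : Kbar K ≃ₐ[K] Kbar K, ∀ (s : X →ₐ[K] Kbar K) (x : X),
      s (ψ ⟨p, hp⟩ x) = σ (s x) := by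

  classical
  let b := Module.finBasis K X
  let S : Set (Kbar K) := Set.range fun z : (X →ₐ[K] Kbar K) × Fin (Module.finrank K X) => z.1 (b z.2)
  have hSfin : S.Finite := Set.finite_range _
  let F := IntermediateField.adjoin K S
  have : Finite S := hSfin
  have hFfin : FiniteDimensional K F :=
    IntermediateField.finiteDimensional_adjoin fun x _ => Algebra.IsIntegral.isIntegral x
  let L := IntermediateField.normalClosure K F (Kbar K)
  have hFL : F ≤ L := IntermediateField.le_normalClosure F
  have : FiniteDimensional K L := normalClosure.is_finiteDimensional K F (Kbar K)
  have : Normal K L := normalClosure.normal K F (Kbar K)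
  have : IsGalois K L := ⟨⟩
  have : NumberField L := NumberField.of_module_finite K L
  have hmem : ∀ (s : X →ₐ[K] Kbar K) (x : X), s x ∈ L := by
    intro s x
    rw [← b.sum_repr x, map_sum]
    refine sum_mem fun i _ => ?_
    rw [map_smul]
    exact L.smul_mem (hFL (IntermediateField.subset_adjoin K S ⟨(s, i), rfl⟩))
  obtain ⟨σ, hσ⟩ := core_galois K X L ψ A hA p hprime hp hbij
  refine ⟨σ.liftNormal (Kbar K), fun s x => ?_⟩
  let s' : X →ₐ[K] L := s.codRestrict L.toSubalgebra (hmem s)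
  have h1 := congrArg (algebraMap L (Kbar K)) (hσ s' x)
  rw [← AlgEquiv.liftNormal_commutes] at h1
  exact h1
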